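/- Let (p_t(x,·)) be an affine family of transition kernels on K with associated functions φ and ψ. For a continuous function f : K → ℝ vanishing at infinity define P_t f(x) = ∫_K f(ξ) p_t(x,dξ). Then the induced semigroup is Feller: for every t ≥ 0 and every continuous f vanishing at infinity, P_t f is again continuous and vanishes at infinity, and sup_{x ∈ K} |P_t f(x) − f(x)| → 0 as t → 0⁺. -/

import Mathlib

open MeasureTheory Filter Set
open scoped RealInnerProductSpace ENNReal Topology Classical

variable {V : Type*} [NormedAddCommGroup V] [InnerProductSpace ℝ V] [FiniteDimensional ℝ V]
  [MeasurableSpace V] [BorelSpace V]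

/-- The closed dual cone of a set `K`. -/
def dualCone (K : Set V) : Set V := {u | ∀ x ∈ K, 0 ≤ ⟪x, u⟫}

/-- `K` is a proper (pointed) generating closed convex cone. -/
structure IsProperConvexCone (K : Set V) : Prop where
  isClosed : IsClosed K
  convex : Convex ℝ K
  smul_mem : ∀ (c : ℝ), 0 ≤ c → ∀ x ∈ K, c • x ∈ K
  proper : K ∩ (-K) = {0}
  generating : ∀ v : V, ∃ x ∈ K, ∃ y ∈ K, v = x - y

/-- An affine family of transition kernels on the cone `K`, with associated
functions `φ` and `ψ`. -/
structure AffineTransitionFamily (K : Set V) (φ : ℝ → V → ℝ) (ψ : ℝ → V → V) where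
  p : ℝ → V → Measure V
  measurable_p : ∀ t : ℝ, 0 ≤ t → ∀ A : Set V, MeasurableSet A →
      Measurable fun x => p t x A
  subprob : ∀ t : ℝ, 0 ≤ t → ∀ x ∈ K, p t x Set.univ ≤ 1
  supported : ∀ t : ℝ, 0 ≤ t → ∀ x ∈ K, p t x Kᶜ = 0
  init : ∀ x ∈ K, p 0 x = Measure.dirac x
  chapman : ∀ s t : ℝ, 0 ≤ s → 0 ≤ t → ∀ x ∈ K, ∀ A : Set V, MeasurableSet A →
      p (t + s) x A = ∫⁻ ξ, p t ξ A ∂(p s x)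
  weakCont : ∀ x ∈ K, ∀ f : BoundedContinuousFunction V ℝ,
      ContinuousOn (fun s => ∫ ξ, f ξ ∂(p s x)) (Set.Ici (0 : ℝ))
  laplace : ∀ t : ℝ, 0 ≤ t → ∀ u ∈ dualCone K, ∀ x ∈ K,
      ∫ ξ, Real.exp (-⟪u, ξ⟫) ∂(p t x) = Real.exp (-(φ t u) - ⟪ψ t u, x⟫)

/-- Extension of a function on the subtype `K` to `V` by zero. -/
noncomputable def extendToV {V : Type*} (K : Set V) (f : K → ℝ) : V → ℝ :=
  fun ξ => if h : ξ ∈ K then f ⟨ξ, h⟩ else 0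


set_option linter.unusedSectionVars false
set_option linter.unusedVariables false

/-- Strictly positive functionals on `K`. -/
def strictDual (K : Set V) : Set V := {u | ∃ c : ℝ, 0 < c ∧ ∀ x ∈ K, c * ‖x‖ ≤ ⟪u, x⟫}

theorem strictDual_subset {K : Set V} {u : V} (hu : u ∈ strictDual K) : u ∈ dualCone K := by
  obtain ⟨c, hc, h⟩ := hu
  intro x hx
  rw [real_inner_comm]
  exact le_trans (by positivity) (h x hx)

theorem dualCone_nonneg {K : Set V} {u x : V} (hu : u ∈ dualCone K) (hx : x ∈ K) : 0 ≤ ⟪u, x⟫ := by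
  rw [real_inner_comm]; exact hu x hx

theorem zero_mem_of_proper {K : Set V} (hK : IsProperConvexCone K) : (0 : V) ∈ K := by
  have : (0 : V) ∈ K ∩ (-K) := by rw [hK.proper]; rfl
  exact this.1

theorem add_mem_of_proper {K : Set V} (hK : IsProperConvexCone K) {x y : V} (hx : x ∈ K)
    (hy : y ∈ K) : x + y ∈ K := by
  have h := hK.convex hx hy (a := 1/2) (b := 1/2) (by norm_num) (by norm_num) (by norm_num)
  have h2 := hK.smul_mem 2 (by norm_num) _ h
  rw [smul_add, smul_smul, smul_smul] at h2
  norm_num at h2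
  exact h2

theorem compact_sphere {K : Set V} (hK : IsProperConvexCone K) :
    IsCompact (K ∩ Metric.sphere (0 : V) 1) :=
  (isCompact_sphere (0 : V) 1).inter_left hK.isClosed

theorem strict_of_sphere {K : Set V} (hK : IsProperConvexCone K) {u : V}
    (h : ∀ x ∈ K, ‖x‖ = 1 → 0 < ⟪u, x⟫) : u ∈ strictDual K := by
  have key : ∃ c : ℝ, 0 < c ∧ ∀ x ∈ K, ‖x‖ = 1 → c ≤ ⟪u, x⟫ := by
    rcases (K ∩ Metric.sphere (0 : V) 1).eq_empty_or_nonempty with he | hne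
    · refine ⟨1, one_pos, fun x hx h1 => ?_⟩
      have : x ∈ K ∩ Metric.sphere (0 : V) 1 := ⟨hx, by simpa using h1⟩
      rw [he] at this
      exact this.elim
    · obtain ⟨x0, hx0, hmin⟩ := (compact_sphere hK).exists_isMinOn hne
        (f := fun x => ⟪u, x⟫) (by fun_prop)
      refine ⟨⟪u, x0⟫, h x0 hx0.1 (by simpa using hx0.2), fun x hx h1 => ?_⟩
      exact hmin (⟨hx, by simpa using h1⟩ : x ∈ K ∩ Metric.sphere (0 : V) 1)
  obtain ⟨c, hc, hcx⟩ := key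
  refine ⟨c, hc, fun x hx => ?_⟩
  rcases eq_or_ne x 0 with rfl | hne
  · simp
  have hn : 0 < ‖x‖ := norm_pos_iff.2 hne
  have := hcx (‖x‖⁻¹ • x) (hK.smul_mem _ (by positivity) x hx)
    (by rw [norm_smul, norm_inv, norm_norm, inv_mul_cancel₀ hn.ne'])
  rw [real_inner_smul_right, inv_mul_eq_div, le_div_iff₀ hn] at this
  exact this

theorem strict_or {K : Set V} (hK : IsProperConvexCone K) {u : V} (hu : u ∈ dualCone K)
    (hn : u ∉ strictDual K) : ∃ x ∈ K, ‖x‖ = 1 ∧ ⟪u, x⟫ = 0 := by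
  by_contra hcon
  push Not at hcon
  exact hn (strict_of_sphere hK fun x hx h1 =>
    lt_of_le_of_ne (dualCone_nonneg hu hx) (hcon x hx h1).symm)

theorem strict_near {K : Set V} {u w : V} {c : ℝ} (h : ∀ x ∈ K, c * ‖x‖ ≤ ⟪u, x⟫)
    (hw : ‖w - u‖ ≤ c / 2) : ∀ x ∈ K, c / 2 * ‖x‖ ≤ ⟪w, x⟫ := by
  intro x hx
  have h1 := h x hx
  have h2 : |⟪w - u, x⟫| ≤ ‖w - u‖ * ‖x‖ := abs_real_inner_le_norm _ _
  have h3 : ⟪w, x⟫ = ⟪u, x⟫ + ⟪w - u, x⟫ := by rw [inner_sub_left]; ring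
  have h4 := mul_le_mul_of_nonneg_right hw (norm_nonneg x)
  have h5 := (abs_le.1 h2).1
  linarith

theorem exists_sep {K : Set V} (hK : IsProperConvexCone K) {x : V} (hx : x ∈ K) (h1 : ‖x‖ = 1) :
    ∃ y ∈ dualCone K, 0 < ⟪y, x⟫ := by
  let C : ProperCone ℝ V :=
    { carrier := K
      add_mem' := fun ha hb => add_mem_of_proper hK ha hb
      zero_mem' := zero_mem_of_proper hK
      smul_mem' := fun c x hx => hK.smul_mem c.1 c.2 x hx
      isClosed' := hK.isClosed }
  have hC : ∀ z, z ∈ C ↔ z ∈ K := fun z => Iff.rfl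
  have hnx : -x ∉ C := by
    rw [hC]
    intro h
    have : x ∈ K ∩ (-K) := ⟨hx, h⟩
    rw [hK.proper] at this
    rw [this] at h1
    simp at h1
  obtain ⟨y, hy, hlt⟩ := C.hyperplane_separation' hnx
  refine ⟨y, fun z hz => hy z hz, ?_⟩
  rw [inner_neg_left, real_inner_comm] at hlt
  linarith

theorem strict_nonempty {K : Set V} (hK : IsProperConvexCone K) : ∃ u, u ∈ strictDual K := by
  obtain ⟨t, ht⟩ := (compact_sphere hK).elim_finite_subcover
    (fun y : dualCone K => {x : V | 0 < ⟪(y : V), x⟫})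
    (fun y => isOpen_lt continuous_const (by fun_prop))
    (by
      rintro x ⟨hx, h1⟩
      obtain ⟨y, hy, h⟩ := exists_sep hK hx (by simpa using h1)
      exact mem_iUnion.2 ⟨⟨y, hy⟩, h⟩)
  refine ⟨∑ y ∈ t, (y : V), strict_of_sphere hK fun x hx h1 => ?_⟩
  have := ht (⟨hx, by simpa using h1⟩ : x ∈ K ∩ Metric.sphere (0 : V) 1)
  simp only [mem_iUnion] at this
  obtain ⟨y, hy, hpos⟩ := this
  rw [sum_inner]
  exact Finset.sum_pos' (fun z _ => dualCone_nonneg z.2 hx) ⟨y, hy, hpos⟩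

theorem ext_of_cone {K : Set V} (hK : IsProperConvexCone K) {u v : V}
    (h : ∀ x ∈ K, ⟪u, x⟫ = ⟪v, x⟫) : u = v := by
  refine ext_inner_right ℝ fun z => ?_
  obtain ⟨x, hx, y, hy, rfl⟩ := hK.generating z
  rw [inner_sub_right, inner_sub_right, h x hx, h y hy]

section Family
variable {K : Set V} {φ : ℝ → V → ℝ} {ψ : ℝ → V → V}

theorem exp_lin_bound {a b : ℝ} (h : ∀ n : ℕ, a ≤ n * b) : 0 ≤ b := by
  by_contra hb
  push Not at hb
  obtain ⟨n, hn⟩ := exists_nat_gt (a / b)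
  have := h n
  rw [div_lt_iff_of_neg hb] at hn
  linarith

theorem fin_p (X : AffineTransitionFamily K φ ψ) {t : ℝ} (ht : 0 ≤ t) {x : V} (hx : x ∈ K) :
    IsFiniteMeasure (X.p t x) :=
  ⟨lt_of_le_of_lt (X.subprob t ht x hx) ENNReal.one_lt_top⟩

theorem real_p (X : AffineTransitionFamily K φ ψ) {t : ℝ} (ht : 0 ≤ t) {x : V} (hx : x ∈ K) :
    (X.p t x).real univ ≤ 1 :=
  ENNReal.toReal_le_of_le_ofReal zero_le_one (by simpa using X.subprob t ht x hx)

theorem ae_p (X : AffineTransitionFamily K φ ψ) {t : ℝ} (ht : 0 ≤ t) {x : V} (hx : x ∈ K) :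
    ∀ᵐ ξ ∂(X.p t x), ξ ∈ K := X.supported t ht x hx

theorem integrable_exp (X : AffineTransitionFamily K φ ψ) {t : ℝ} (ht : 0 ≤ t) {x : V} (hx : x ∈ K)
    {u : V} (hu : u ∈ dualCone K) : Integrable (fun ξ => Real.exp (-⟪u, ξ⟫)) (X.p t x) := by
  have := fin_p X ht hx
  refine Integrable.of_bound (C := 1) (by fun_prop) ?_
  filter_upwards [ae_p X ht hx] with ξ hξ
  rw [Real.norm_eq_abs, abs_of_pos (Real.exp_pos _), Real.exp_le_one_iff]
  linarith [dualCone_nonneg hu hξ]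

theorem laplace_le_one (X : AffineTransitionFamily K φ ψ) {t : ℝ} (ht : 0 ≤ t) {x : V} (hx : x ∈ K)
    {u : V} (hu : u ∈ dualCone K) : 0 ≤ φ t u + ⟪ψ t u, x⟫ := by
  have := fin_p X ht hx
  have h1 := norm_integral_le_of_norm_le_const (μ := X.p t x) (C := 1)
    (f := fun ξ => Real.exp (-⟪u, ξ⟫)) (by
    filter_upwards [ae_p X ht hx] with ξ hξ
    rw [Real.norm_eq_abs, abs_of_pos (Real.exp_pos _), Real.exp_le_one_iff]
    linarith [dualCone_nonneg hu hξ])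
  rw [X.laplace t ht u hu x hx, Real.norm_eq_abs, abs_of_pos (Real.exp_pos _), one_mul] at h1
  have := h1.trans (real_p X ht hx)
  rw [Real.exp_le_one_iff] at this
  linarith

theorem psi_mem (hK : IsProperConvexCone K) (X : AffineTransitionFamily K φ ψ) {t : ℝ}
    (ht : 0 ≤ t) {u : V} (hu : u ∈ dualCone K) : ψ t u ∈ dualCone K := by
  intro x hx
  rw [real_inner_comm]
  refine exp_lin_bound (a := -φ t u) fun n => ?_
  have := laplace_le_one X ht (hK.smul_mem (n : ℝ) (by positivity) x hx) hu
  rw [real_inner_smul_right] at this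
  linarith

/-- Cauchy-Schwarz step. -/
theorem psi_double (hK : IsProperConvexCone K) (X : AffineTransitionFamily K φ ψ) {t : ℝ}
    (ht : 0 ≤ t) {v w : V} (hv : v ∈ dualCone K) (hw : w ∈ dualCone K)
    (hle : ∀ ξ ∈ K, ⟪w, ξ⟫ ≤ 2 * ⟪v, ξ⟫) {x : V} (hx : x ∈ K)
    (h0 : ⟪ψ t v, x⟫ = 0) : ⟪ψ t w, x⟫ = 0 := by
  refine le_antisymm ?_ (dualCone_nonneg (psi_mem hK X ht hw) hx)
  set A := Real.exp (-φ t v) with hA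
  have hApos : 0 < A := Real.exp_pos _
  have key : ∀ n : ℕ, A ^ 2 ≤ Real.exp (-φ t w - n * ⟪ψ t w, x⟫) := by
    intro n
    have hnx := hK.smul_mem (n : ℝ) (by positivity) x hx
    have := fin_p X ht hnx
    have e1 := X.laplace t ht v hv _ hnx
    have e2 := X.laplace t ht w hw _ hnx
    rw [real_inner_smul_right, h0, mul_zero, sub_zero] at e1
    rw [real_inner_smul_right] at e2
    have hm := integral_mono_ae (μ := X.p t ((n : ℝ) • x))
      (f := fun ξ => 2 * A * Real.exp (-⟪v, ξ⟫)) (g := fun ξ => A ^ 2 + Real.exp (-⟪w, ξ⟫))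
      ((integrable_exp X ht hnx hv).const_mul _)
      ((integrable_const _).add (integrable_exp X ht hnx hw))
      (by
        filter_upwards [ae_p X ht hnx] with ξ hξ
        have h2 : Real.exp (-⟪v, ξ⟫) ^ 2 ≤ Real.exp (-⟪w, ξ⟫) := by
          rw [← Real.exp_nat_mul, Real.exp_le_exp]
          push_cast
          linarith [hle ξ hξ]
        have := sq_nonneg (A - Real.exp (-⟪v, ξ⟫))
        show 2 * A * Real.exp (-⟪v, ξ⟫) ≤ A ^ 2 + Real.exp (-⟪w, ξ⟫)
        nlinarith)
    rw [integral_const_mul, integral_add (integrable_const _) (integrable_exp X ht hnx hw),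
      integral_const, e1, e2, smul_eq_mul] at hm
    have hr := mul_le_mul_of_nonneg_right (real_p X ht hnx) (sq_nonneg A)
    nlinarith
  have := exp_lin_bound (a := φ t w + Real.log (A ^ 2)) (b := -⟪ψ t w, x⟫) fun n => by
    have := (Real.le_log_iff_exp_le (by positivity : 0 < Real.exp (-φ t w - n * ⟪ψ t w, x⟫))
      (x := Real.log (A ^ 2))).2 (by rw [Real.exp_log (by positivity)]; exact key n)
    rw [Real.log_exp] at this
    linarith
  linarith

theorem psi_zero_all (hK : IsProperConvexCone K) (X : AffineTransitionFamily K φ ψ) {t : ℝ}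
    (ht : 0 ≤ t) {v w : V} (hv : v ∈ strictDual K) (hw : w ∈ dualCone K)
    {x : V} (hx : x ∈ K)
    (h0 : ⟪ψ t v, x⟫ = 0) : ⟪ψ t w, x⟫ = 0 := by
  have hsm : ∀ n : ℕ, ((2 : ℝ) ^ n) • v ∈ dualCone K := fun n y hy => by
    rw [real_inner_smul_right]
    exact mul_nonneg (by positivity) (strictDual_subset hv y hy)
  have hpow : ∀ n : ℕ, ⟪ψ t (((2 : ℝ) ^ n) • v), x⟫ = 0 := by
    intro n
    induction n with
    | zero => simpa using h0
    | succ n ih =>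
      refine psi_double hK X ht (hsm n) (hsm (n + 1)) (fun ξ hξ => ?_) hx ih
      rw [real_inner_smul_left, real_inner_smul_left, pow_succ]
      exact le_of_eq (by ring)
  obtain ⟨c, hc, hcv⟩ := hv
  obtain ⟨n, hn⟩ := pow_unbounded_of_one_lt (‖w‖ / c) (by norm_num : (1 : ℝ) < 2)
  refine psi_double hK X ht (hsm n) hw (fun ξ hξ => ?_) hx (hpow n)
  rw [real_inner_smul_left]
  rw [div_lt_iff₀ hc] at hn
  have h1 : ⟪w, ξ⟫ ≤ ‖w‖ * ‖ξ‖ := real_inner_le_norm _ _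
  have h2 := mul_le_mul_of_nonneg_right hn.le (norm_nonneg ξ)
  have h3 := mul_le_mul_of_nonneg_left (hcv ξ hξ) (by positivity : (0 : ℝ) ≤ 2 ^ n)
  have h4 : 0 ≤ ‖w‖ * ‖ξ‖ := by positivity
  nlinarith

theorem semiflow (hK : IsProperConvexCone K) (X : AffineTransitionFamily K φ ψ) {s t : ℝ}
    (hs : 0 ≤ s) (ht : 0 ≤ t) {u : V} (hu : u ∈ dualCone K) :
    ψ (t + s) u = ψ s (ψ t u) := by
  have hmem := psi_mem hK X ht hu
  have key : ∀ x ∈ K, φ (t + s) u + ⟪ψ (t + s) u, x⟫ =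
      φ t u + φ s (ψ t u) + ⟪ψ s (ψ t u), x⟫ := by
    intro x hx
    have hmeas : Measurable (X.p t) :=
      Measure.measurable_of_measurable_coe _ (fun A hA => X.measurable_p t ht A hA)
    have hbind : X.p (t + s) x = (X.p s x).bind (X.p t) := by
      ext A hA
      rw [Measure.bind_apply hA hmeas.aemeasurable, X.chapman s t hs ht x hx A hA]
    have hl : ∀ {r : ℝ} (_ : 0 ≤ r) {y : V} (_ : y ∈ K) {v : V} (_ : v ∈ dualCone K),
        ∫⁻ ξ, ENNReal.ofReal (Real.exp (-⟪v, ξ⟫)) ∂(X.p r y) =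
          ENNReal.ofReal (Real.exp (-(φ r v) - ⟪ψ r v, y⟫)) := by
      intro r hr y hy v hv
      rw [← X.laplace r hr v hv y hy, ofReal_integral_eq_lintegral_ofReal
        (integrable_exp X hr hy hv) (ae_of_all _ fun _ => (Real.exp_pos _).le)]
    have h1 := hl (add_nonneg ht hs) hx hu
    rw [hbind, Measure.lintegral_bind hmeas.aemeasurable (by fun_prop)] at h1
    have h2 : ∫⁻ ξ, ∫⁻ η, ENNReal.ofReal (Real.exp (-⟪u, η⟫)) ∂(X.p t ξ) ∂(X.p s x) =
        ∫⁻ ξ, ENNReal.ofReal (Real.exp (-φ t u)) *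
          ENNReal.ofReal (Real.exp (-⟪ψ t u, ξ⟫)) ∂(X.p s x) := by
      refine lintegral_congr_ae ?_
      filter_upwards [ae_p X hs hx] with ξ hξ
      rw [hl ht hξ hu, ← ENNReal.ofReal_mul (Real.exp_pos _).le, ← Real.exp_add, sub_eq_add_neg]
    rw [h2, lintegral_const_mul _ (by fun_prop), hl hs hx hmem,
      ← ENNReal.ofReal_mul (Real.exp_pos _).le, ← Real.exp_add,
      ENNReal.ofReal_eq_ofReal_iff (Real.exp_pos _).le (Real.exp_pos _).le, Real.exp_eq_exp] at h1
    linarith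
  refine ext_of_cone hK fun x hx => ?_
  have k0 := key 0 (zero_mem_of_proper hK)
  have k1 := key x hx
  simp only [inner_zero_right] at k0
  linarith

theorem phi_psi_tendsto (hK : IsProperConvexCone K) (X : AffineTransitionFamily K φ ψ)
    {u : V} (hu : u ∈ dualCone K) {x : V} (hx : x ∈ K) :
    Tendsto (fun t => φ t u + ⟪ψ t u, x⟫) (𝓝[>] 0) (𝓝 ⟪u, x⟫) := by
  let f : BoundedContinuousFunction V ℝ :=
    BoundedContinuousFunction.ofNormedAddCommGroup (fun ξ => Real.exp (-(max ⟪u, ξ⟫ 0)))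
      (by fun_prop) 1 (fun ξ => by
        rw [Real.norm_eq_abs, abs_of_pos (Real.exp_pos _), Real.exp_le_one_iff]
        simp)
  have hf : ∀ t : ℝ, 0 ≤ t → ∫ ξ, f ξ ∂(X.p t x) = Real.exp (-(φ t u + ⟪ψ t u, x⟫)) := by
    intro t ht
    rw [neg_add', ← X.laplace t ht u hu x hx]
    refine integral_congr_ae ?_
    filter_upwards [ae_p X ht hx] with ξ hξ
    show Real.exp (-(max ⟪u, ξ⟫ 0)) = _
    rw [max_eq_left (dualCone_nonneg hu hξ)]
  have hc := (X.weakCont x hx f) 0 (by simp)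
  have h0 : ∫ ξ, f ξ ∂(X.p 0 x) = Real.exp (-⟪u, x⟫) := by
    rw [X.init x hx, integral_dirac]
    show Real.exp (-(max ⟪u, x⟫ 0)) = _
    rw [max_eq_left (dualCone_nonneg hu hx)]
  have hc' : Tendsto (fun t => ∫ ξ, f ξ ∂(X.p t x)) (𝓝[>] 0) (𝓝 (Real.exp (-⟪u, x⟫))) := by
    rw [← h0]
    exact hc.mono_left (nhdsWithin_mono _ Ioi_subset_Ici_self)
  have h3 := (hc'.log (Real.exp_pos _).ne').neg
  rw [Real.log_exp, neg_neg] at h3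
  refine h3.congr' ?_
  filter_upwards [self_mem_nhdsWithin] with t ht
  rw [hf t (le_of_lt ht), Real.log_exp, neg_neg]

theorem phi_tendsto (hK : IsProperConvexCone K) (X : AffineTransitionFamily K φ ψ)
    {u : V} (hu : u ∈ dualCone K) : Tendsto (fun t => φ t u) (𝓝[>] 0) (𝓝 0) := by
  simpa using phi_psi_tendsto hK X hu (zero_mem_of_proper hK)

theorem psi_tendsto (hK : IsProperConvexCone K) (X : AffineTransitionFamily K φ ψ)
    {u : V} (hu : u ∈ dualCone K) : Tendsto (fun t => ψ t u) (𝓝[>] 0) (𝓝 u) := by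
  have hall : ∀ z : V, Tendsto (fun t => ⟪ψ t u, z⟫) (𝓝[>] 0) (𝓝 ⟪u, z⟫) := by
    have hx : ∀ x ∈ K, Tendsto (fun t => ⟪ψ t u, x⟫) (𝓝[>] 0) (𝓝 ⟪u, x⟫) := fun x hx => by
      simpa using (phi_psi_tendsto hK X hu hx).sub (phi_tendsto hK X hu)
    intro z
    obtain ⟨x, hxK, y, hyK, rfl⟩ := hK.generating z
    simp only [inner_sub_right]
    exact (hx x hxK).sub (hx y hyK)
  let b := stdOrthonormalBasis ℝ V
  have : Tendsto (fun t => ∑ i, ⟪ψ t u, b i⟫ • b i) (𝓝[>] 0) (𝓝 (∑ i, ⟪u, b i⟫ • b i)) :=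
    tendsto_finsetSum _ fun i _ => (hall (b i)).smul_const _
  have hb : ∀ w : V, ∑ i, ⟪w, b i⟫ • b i = w := fun w => by
    conv_rhs => rw [← b.sum_repr' w]
    exact Finset.sum_congr rfl fun i _ => by rw [real_inner_comm]
  simpa only [hb] using this

theorem psi_strict (hK : IsProperConvexCone K) (X : AffineTransitionFamily K φ ψ) {t : ℝ}
    (ht : 0 ≤ t) {u : V} (hu : u ∈ strictDual K) : ψ t u ∈ strictDual K := by
  rcases ht.eq_or_lt with rfl | htpos
  · have : ψ 0 u = u := by
      have hud := strictDual_subset hu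
      have key : ∀ x ∈ K, φ 0 u + ⟪ψ 0 u, x⟫ = ⟪u, x⟫ := fun x hx => by
        have := X.laplace 0 le_rfl u hud x hx
        rw [X.init x hx, integral_dirac, Real.exp_eq_exp] at this
        linarith
      refine ext_of_cone hK fun x hx => ?_
      have k0 := key 0 (zero_mem_of_proper hK)
      have k1 := key x hx
      simp only [inner_zero_right] at k0
      linarith
    rwa [this]
  by_contra hbad
  have step : ∀ n : ℕ, ∃ v ∈ strictDual K, ψ (t / 2 ^ n) v ∉ strictDual K := by
    intro n
    induction n with
    | zero => exact ⟨u, hu, by simpa using hbad⟩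
    | succ n ih =>
      by_contra hcon
      push Not at hcon
      obtain ⟨v, hv, hvn⟩ := ih
      apply hvn
      have e : t / 2 ^ n = t / 2 ^ (n + 1) + t / 2 ^ (n + 1) := by
        rw [pow_succ]; field_simp; ring
      rw [e, semiflow hK X (by positivity) (by positivity) (strictDual_subset hv)]
      exact hcon _ (hcon _ hv)
  have hnot : ∀ n : ℕ, ψ (t / 2 ^ n) u ∉ strictDual K := by
    intro n
    obtain ⟨v, hv, hvn⟩ := step n
    have htn : 0 ≤ t / 2 ^ n := by positivity
    obtain ⟨x, hx, h1, h0⟩ := strict_or hK (psi_mem hK X htn (strictDual_subset hv)) hvn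
    have hz := psi_zero_all hK X htn hv (strictDual_subset hu) hx h0
    rintro ⟨c, hc, h⟩
    have := h x hx
    rw [hz, h1] at this
    linarith
  have hlim : Tendsto (fun n : ℕ => t / 2 ^ n) atTop (𝓝[>] 0) := by
    refine tendsto_nhdsWithin_iff.2 ⟨?_, Eventually.of_forall fun n => by
      show 0 < t / 2 ^ n
      positivity⟩
    have := (tendsto_pow_atTop_nhds_zero_of_lt_one (r := (1 / 2 : ℝ)) (by norm_num)
      (by norm_num)).const_mul t
    simpa [div_eq_mul_inv] using this
  have hps := (psi_tendsto hK X (strictDual_subset hu)).comp hlim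
  obtain ⟨c, hc, h⟩ := hu
  have hev := hps.eventually (Metric.closedBall_mem_nhds u (half_pos hc))
  obtain ⟨n, hn⟩ := hev.exists
  refine hnot n ⟨c / 2, half_pos hc, strict_near h ?_⟩
  simpa [dist_eq_norm] using hn

end Family

theorem exp_tendsto {K : Set V} (hK : IsProperConvexCone K) {u : V} (hu : u ∈ strictDual K)
    (a : ℝ) : Tendsto (fun x : K => Real.exp (-a - ⟪u, (x : V)⟫)) (cocompact K) (𝓝 0) := by
  obtain ⟨c, hc, h⟩ := hu
  have h1 : Tendsto (fun x : K => ‖(x : V)‖) (cocompact K) atTop :=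
    (tendsto_norm_cocompact_atTop (E := V)).comp
      hK.isClosed.isClosedEmbedding_subtypeVal.tendsto_cocompact
  have h2 : Tendsto (fun x : K => ⟪u, (x : V)⟫) (cocompact K) atTop :=
    tendsto_atTop_mono (fun x : K => h x x.2) (h1.const_mul_atTop hc)
  refine Real.tendsto_exp_atBot.comp ?_
  simp only [sub_eq_add_neg]
  exact tendsto_atBot_add_const_left _ _ (tendsto_neg_atTop_atBot.comp h2)

/-- The exponential on the one-point compactification. -/
noncomputable def expMap {K : Set V} (hK : IsProperConvexCone K) (u : strictDual K) :
    C(OnePoint K, ℝ) :=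
  OnePoint.continuousMapMk ⟨fun x : K => Real.exp (-⟪(u : V), (x : V)⟫), by fun_prop⟩ 0 (by
    rw [coclosedCompact_eq_cocompact]
    simpa using exp_tendsto hK u.2 0)

theorem expMap_coe {K : Set V} (hK : IsProperConvexCone K) (u : strictDual K) (x : K) :
    expMap hK u (x : OnePoint K) = Real.exp (-⟪(u : V), (x : V)⟫) := rfl

theorem expMap_infty {K : Set V} (hK : IsProperConvexCone K) (u : strictDual K) :
    expMap hK u OnePoint.infty = 0 := rfl

theorem strict_add {K : Set V} {u v : V} (hu : u ∈ strictDual K) (hv : v ∈ strictDual K) :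
    u + v ∈ strictDual K := by
  obtain ⟨c, hc, h⟩ := hu
  obtain ⟨d, hd, h'⟩ := hv
  refine ⟨c + d, by positivity, fun x hx => ?_⟩
  rw [inner_add_left, add_mul]
  exact add_le_add (h x hx) (h' x hx)

theorem expMap_mul {K : Set V} (hK : IsProperConvexCone K) (u v : strictDual K) :
    expMap hK u * expMap hK v = expMap hK ⟨u + v, strict_add u.2 v.2⟩ := by
  ext z
  induction z using OnePoint.rec with
  | infty => simp [expMap_infty]
  | coe x =>
    rw [ContinuousMap.mul_apply, expMap_coe, expMap_coe, expMap_coe, ← Real.exp_add]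
    simp only [inner_add_left]
    congr 1
    ring

theorem adjoin_sub {K : Set V} (hK : IsProperConvexCone K) {g : C(OnePoint K, ℝ)}
    (hg : g ∈ Algebra.adjoin ℝ (range (expMap hK))) :
    g ∈ Submodule.span ℝ (insert 1 (range (expMap hK))) := by
  let M : Submonoid C(OnePoint K, ℝ) :=
    { carrier := insert 1 (range (expMap hK))
      one_mem' := Or.inl rfl
      mul_mem' := by
        rintro a b (rfl | ⟨u, rfl⟩) (rfl | ⟨v, rfl⟩)
        · left; simp
        · right; exact ⟨v, by simp⟩
        · right; exact ⟨u, by simp⟩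
        · right; exact ⟨_, (expMap_mul hK u v).symm⟩ }
  rw [← Subalgebra.mem_toSubmodule, Algebra.adjoin_eq_span] at hg
  refine Submodule.span_mono ?_ hg
  have : Submonoid.closure (range (expMap hK)) ≤ M :=
    Submonoid.closure_le.2 (fun x hx => Or.inr hx)
  exact this

theorem exists_strict_sep {K : Set V} (hK : IsProperConvexCone K) {x y : V} (hxy : x ≠ y) :
    ∃ u ∈ strictDual K, ⟪u, x⟫ ≠ ⟪u, y⟫ := by
  obtain ⟨u, hu⟩ := strict_nonempty hK
  by_cases h : ⟪u, x⟫ = ⟪u, y⟫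
  swap
  · exact ⟨u, hu, h⟩
  obtain ⟨c, hc, hcu⟩ := hu
  have hn : 0 < ‖x - y‖ := norm_pos_iff.2 (sub_ne_zero.2 hxy)
  refine ⟨u + (c / 2 / ‖x - y‖) • (x - y), ⟨c / 2, half_pos hc, strict_near hcu ?_⟩, ?_⟩
  · rw [add_sub_cancel_left, norm_smul, Real.norm_eq_abs, abs_of_pos (by positivity)]
    field_simp
    exact le_rfl
  · intro he
    have : ⟪u + (c / 2 / ‖x - y‖) • (x - y), x - y⟫ = 0 := by rw [inner_sub_right, he, sub_self]
    rw [inner_add_left, inner_sub_right, h, sub_self, zero_add, real_inner_smul_left,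
      real_inner_self_eq_norm_sq] at this
    have hp : 0 < c / 2 / ‖x - y‖ * ‖x - y‖ ^ 2 := by positivity
    linarith

theorem sep_points {K : Set V} (hK : IsProperConvexCone K) :
    (Algebra.adjoin ℝ (range (expMap hK))).SeparatesPoints := by
  obtain ⟨u0, hu0⟩ := strict_nonempty hK
  intro a b hab
  have mk : ∀ u : strictDual K, expMap hK u a ≠ expMap hK u b →
      ∃ f ∈ (fun f : C(OnePoint K, ℝ) => (f : OnePoint K → ℝ)) ''
        ((Algebra.adjoin ℝ (range (expMap hK)) : Subalgebra ℝ C(OnePoint K, ℝ)) : Set _),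
        f a ≠ f b :=
    fun u h => ⟨_, ⟨expMap hK u, Algebra.subset_adjoin ⟨u, rfl⟩, rfl⟩, h⟩
  induction a using OnePoint.rec with
  | infty =>
    induction b using OnePoint.rec with
    | infty => exact (hab rfl).elim
    | coe y =>
      refine mk ⟨u0, hu0⟩ ?_
      rw [expMap_coe, expMap_infty]
      exact (Real.exp_pos _).ne
  | coe x =>
    induction b using OnePoint.rec with
    | infty =>
      refine mk ⟨u0, hu0⟩ ?_
      rw [expMap_coe, expMap_infty]
      exact (Real.exp_pos _).ne'
    | coe y =>
      have hxy : (x : V) ≠ y := fun h => hab (by rw [Subtype.ext h])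
      obtain ⟨u, hu, hne⟩ := exists_strict_sep hK hxy
      refine mk ⟨u, hu⟩ ?_
      rw [expMap_coe, expMap_coe]
      intro h
      exact hne (neg_injective (Real.exp_injective h))

theorem approx {K : Set V} (hK : IsProperConvexCone K) (f : ZeroAtInftyContinuousMap K ℝ)
    {ε : ℝ} (hε : 0 < ε) : ∃ (n : ℕ) (c : Fin n → ℝ) (u : Fin n → V),
      (∀ i, u i ∈ strictDual K) ∧
      ∀ x : K, |f x - ∑ i, c i * Real.exp (-⟪u i, (x : V)⟫)| < ε := by
  have : LocallyCompactSpace K := hK.isClosed.isClosedEmbedding_subtypeVal.locallyCompactSpace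
  let F : C(OnePoint K, ℝ) := OnePoint.continuousMapMk f.toContinuousMap 0 (by
    rw [coclosedCompact_eq_cocompact]; exact f.zero_at_infty')
  obtain ⟨⟨g, hg⟩, hgF⟩ :=
    ContinuousMap.exists_mem_subalgebra_near_continuousMap_of_separatesPoints _ (sep_points hK)
      F (ε / 2) (half_pos hε)
  obtain ⟨a, z, hz, hgz⟩ := Submodule.mem_span_insert.1 (adjoin_sub hK hg)
  obtain ⟨n, c, w, hw⟩ := Submodule.mem_span_set'.1 hz
  choose u hu using fun i => (w i).2
  have hpt : ∀ y : OnePoint K, |g y - F y| < ε / 2 := fun y =>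
    lt_of_le_of_lt ((g - F).norm_coe_le_norm y) hgF
  have hsum : ∀ y, z y = ∑ i, c i * expMap hK (u i) y := by
    intro y
    rw [← hw, ContinuousMap.sum_apply]
    refine Finset.sum_congr rfl fun i _ => ?_
    rw [hu i]; rfl
  have hgy : ∀ y, g y = a + ∑ i, c i * expMap hK (u i) y := by
    intro y
    have : g y = a * 1 + z y := by
      rw [hgz]; rfl
    rw [this, hsum, mul_one]
  refine ⟨n, c, fun i => u i, fun i => (u i).2, fun x => ?_⟩
  have h1 := hpt OnePoint.infty
  have h2 := hpt (x : OnePoint K)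
  rw [hgy] at h1 h2
  have hF0 : F OnePoint.infty = 0 := rfl
  have hFx : F (x : OnePoint K) = f x := rfl
  simp only [expMap_infty, mul_zero, Finset.sum_const_zero, hF0] at h1
  simp only [expMap_coe, hFx] at h2
  rw [abs_lt] at h1 h2 ⊢
  constructor <;> linarith [h1.1, h1.2, h2.1, h2.2]

section Family2
variable {K : Set V} {φ : ℝ → V → ℝ} {ψ : ℝ → V → V}

theorem int_approx (hK : IsProperConvexCone K) (X : AffineTransitionFamily K φ ψ)
    (f : ZeroAtInftyContinuousMap K ℝ) {ε : ℝ} {n : ℕ} {c : Fin n → ℝ} {u : Fin n → V}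
    (hu : ∀ i, u i ∈ strictDual K)
    (h : ∀ x : K, |f x - ∑ i, c i * Real.exp (-⟪u i, (x : V)⟫)| < ε) {t : ℝ} (ht : 0 ≤ t) (x : K) :
    |(∫ ξ, extendToV K f ξ ∂(X.p t (x : V))) -
      ∑ i, c i * Real.exp (-φ t (u i) - ⟪ψ t (u i), (x : V)⟫)| ≤ ε := by
  have := fin_p X ht x.2
  have hεpos : 0 ≤ ε := le_trans (abs_nonneg _) (h x).le
  have hmeas : Measurable (extendToV K f) :=
    Measurable.dite (s := K) (f := fun y => f y) (g := fun _ => (0 : ℝ))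
      f.continuous.measurable measurable_const hK.isClosed.measurableSet
  have hint : Integrable (fun ξ => ∑ i, c i * Real.exp (-⟪u i, ξ⟫)) (X.p t (x : V)) :=
    integrable_finsetSum _ fun i _ =>
      (integrable_exp X ht x.2 (strictDual_subset (hu i))).const_mul _
  have hae : ∀ᵐ ξ ∂(X.p t (x : V)),
      ‖extendToV K f ξ - ∑ i, c i * Real.exp (-⟪u i, ξ⟫)‖ ≤ ε := by
    filter_upwards [ae_p X ht x.2] with ξ hξ
    rw [extendToV, dif_pos hξ, Real.norm_eq_abs]
    exact (h ⟨ξ, hξ⟩).le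
  have hfi : Integrable (extendToV K f) (X.p t (x : V)) := by
    have h1 : Integrable (fun ξ => extendToV K f ξ - ∑ i, c i * Real.exp (-⟪u i, ξ⟫))
        (X.p t (x : V)) :=
      Integrable.of_bound (C := ε) (hmeas.aestronglyMeasurable.sub hint.1) hae
    exact (h1.add hint).congr (ae_of_all _ fun ξ => sub_add_cancel _ _)
  have hs : ∑ i, c i * Real.exp (-φ t (u i) - ⟪ψ t (u i), (x : V)⟫) =
      ∫ ξ, ∑ i, c i * Real.exp (-⟪u i, ξ⟫) ∂(X.p t (x : V)) := by
    rw [integral_finsetSum _ fun i _ =>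
      (integrable_exp X ht x.2 (strictDual_subset (hu i))).const_mul _]
    refine Finset.sum_congr rfl fun i _ => ?_
    rw [integral_const_mul, X.laplace t ht _ (strictDual_subset (hu i)) x x.2]
  rw [hs, ← integral_sub hfi hint]
  have h2 := norm_integral_le_of_norm_le_const hae
  rw [Real.norm_eq_abs] at h2
  have h3 := mul_le_mul_of_nonneg_left (real_p X ht x.2) hεpos
  linarith

theorem exp_diff {a b m : ℝ} (ha : m ≤ a) (hb : m ≤ b) :
    |Real.exp (-a) - Real.exp (-b)| ≤ Real.exp (-m) * |a - b| := by
  wlog hab : a ≤ b generalizing a b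
  · rw [abs_sub_comm, abs_sub_comm a b]
    exact this hb ha (le_of_not_ge hab)
  have h1 : Real.exp (-b) = Real.exp (-a) * Real.exp (-(b - a)) := by
    rw [← Real.exp_add]; congr 1; ring
  have h2 := Real.add_one_le_exp (-(b - a))
  have h3 : Real.exp (-b) ≤ Real.exp (-a) := Real.exp_le_exp.2 (by linarith)
  rw [abs_of_nonneg (by linarith), abs_sub_comm, abs_of_nonneg (by linarith)]
  have h4 : Real.exp (-a) ≤ Real.exp (-m) := Real.exp_le_exp.2 (by linarith)
  have h5 := mul_le_mul_of_nonneg_right h4 (sub_nonneg.2 hab)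
  have h6 := mul_le_mul_of_nonneg_left h2 (Real.exp_pos (-a)).le
  rw [h1]
  nlinarith

theorem exp_unif (hK : IsProperConvexCone K) (X : AffineTransitionFamily K φ ψ) {u : V}
    (hu : u ∈ strictDual K) {ε : ℝ} (hε : 0 < ε) :
    ∀ᶠ t in 𝓝[>] (0 : ℝ), ∀ x : K,
      |Real.exp (-φ t u - ⟪ψ t u, (x : V)⟫) - Real.exp (-⟪u, (x : V)⟫)| < ε := by
  have hud := strictDual_subset hu
  have hψ := psi_tendsto hK X hud
  have hφ := phi_tendsto hK X hud
  obtain ⟨c, hc, h⟩ := hu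
  have e1 := hψ.eventually (Metric.closedBall_mem_nhds u (half_pos hc))
  have e2 : Tendsto (fun t => |φ t u| + ‖ψ t u - u‖ * (2 / c)) (𝓝[>] 0) (𝓝 0) := by
    have := hφ.abs.add (((hψ.sub_const u).norm).mul_const (2 / c))
    simpa using this
  filter_upwards [e1, e2.eventually (gt_mem_nhds hε), self_mem_nhdsWithin] with t h1 h2 ht x
  refine lt_of_le_of_lt ?_ h2
  have hφ0 : 0 ≤ φ t u := by
    simpa using laplace_le_one X (le_of_lt ht) (zero_mem_of_proper hK) hud
  have hn := strict_near h (by simpa [dist_eq_norm] using h1 : ‖ψ t u - u‖ ≤ c / 2) x x.2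
  have hcx := h x x.2
  have hx0 := norm_nonneg (x : V)
  have hd := exp_diff (a := φ t u + ⟪ψ t u, (x : V)⟫) (b := ⟪u, (x : V)⟫) (m := c / 2 * ‖(x : V)‖)
    (by linarith) (by nlinarith)
  rw [neg_add'] at hd
  refine hd.trans ?_
  have hab : |φ t u + ⟪ψ t u, (x : V)⟫ - ⟪u, (x : V)⟫| ≤ |φ t u| + ‖ψ t u - u‖ * ‖(x : V)‖ := by
    rw [add_sub_assoc, ← inner_sub_left]
    exact (abs_add_le _ _).trans (add_le_add le_rfl (abs_real_inner_le_norm _ _))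
  have hm1 : Real.exp (-(c / 2 * ‖(x : V)‖)) ≤ 1 :=
    Real.exp_le_one_iff.2 (by have : 0 ≤ c / 2 * ‖(x : V)‖ := by positivity
                              linarith)
  have hm2 : Real.exp (-(c / 2 * ‖(x : V)‖)) * ‖(x : V)‖ ≤ 2 / c := by
    have := Real.add_one_le_exp (c / 2 * ‖(x : V)‖)
    rw [Real.exp_neg, inv_mul_eq_div, div_le_div_iff₀ (Real.exp_pos _) hc]
    linarith
  calc _ ≤ Real.exp (-(c / 2 * ‖(x : V)‖)) * (|φ t u| + ‖ψ t u - u‖ * ‖(x : V)‖) :=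
        mul_le_mul_of_nonneg_left hab (Real.exp_pos _).le
    _ = Real.exp (-(c / 2 * ‖(x : V)‖)) * |φ t u| +
        ‖ψ t u - u‖ * (Real.exp (-(c / 2 * ‖(x : V)‖)) * ‖(x : V)‖) := by ring
    _ ≤ _ := by
      refine add_le_add ?_ (mul_le_mul_of_nonneg_left hm2 (norm_nonneg _))
      exact mul_le_of_le_one_left (abs_nonneg _) hm1

theorem sum_unif (hK : IsProperConvexCone K) (X : AffineTransitionFamily K φ ψ) {n : ℕ}
    (c : Fin n → ℝ) {u : Fin n → V}
    (hu : ∀ i, u i ∈ strictDual K) {ε : ℝ} (hε : 0 < ε) :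
    ∀ᶠ t in 𝓝[>] (0 : ℝ), ∀ x : K,
      |∑ i, c i * Real.exp (-φ t (u i) - ⟪ψ t (u i), (x : V)⟫) -
        ∑ i, c i * Real.exp (-⟪u i, (x : V)⟫)| ≤ ε := by
  set C : ℝ := ∑ i, |c i| with hC
  have hC0 : 0 ≤ C := Finset.sum_nonneg fun i _ => abs_nonneg _
  have hδ : 0 < ε / (C + 1) := by positivity
  filter_upwards [eventually_all.2 fun i => exp_unif hK X (hu i) hδ] with t ht x
  rw [← Finset.sum_sub_distrib]
  calc _ ≤ ∑ i, |c i * Real.exp (-φ t (u i) - ⟪ψ t (u i), (x : V)⟫) -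
          c i * Real.exp (-⟪u i, (x : V)⟫)| := Finset.abs_sum_le_sum_abs _ _
    _ ≤ ∑ i, |c i| * (ε / (C + 1)) := by
      refine Finset.sum_le_sum fun i _ => ?_
      rw [← mul_sub, abs_mul]
      exact mul_le_mul_of_nonneg_left (ht i x).le (abs_nonneg _)
    _ = C * (ε / (C + 1)) := by rw [← Finset.sum_mul]
    _ ≤ ε := by
      rw [mul_div_assoc', div_le_iff₀ (by positivity)]
      nlinarith

end Family2

/-- The semigroup `P_t f(x) = ∫_K f(ξ) p_t(x,dξ)` induced by an affine
family of transition kernels on `K` is Feller: for `t ≥ 0` and any continuous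
`f : K → ℝ` vanishing at infinity, `P_t f` is continuous on `K` and vanishes at
infinity, and `P_t f → f` uniformly on `K` as `t → 0⁺`. -/
theorem affine_feller
    {V : Type*} [NormedAddCommGroup V] [InnerProductSpace ℝ V] [FiniteDimensional ℝ V]
    [MeasurableSpace V] [BorelSpace V]
    (K : Set V) (hK : IsProperConvexCone K)
    (φ : ℝ → V → ℝ) (ψ : ℝ → V → V)
    (X : AffineTransitionFamily K φ ψ) :
    (∀ t : ℝ, 0 ≤ t → ∀ f : ZeroAtInftyContinuousMap K ℝ,
      Continuous (fun x : K => ∫ ξ, extendToV K f ξ ∂(X.p t (x : V))) ∧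
      Tendsto (fun x : K => ∫ ξ, extendToV K f ξ ∂(X.p t (x : V)))
        (cocompact K) (nhds 0)) ∧
    ∀ f : ZeroAtInftyContinuousMap K ℝ, ∀ ε : ℝ, 0 < ε → ∃ δ : ℝ, 0 < δ ∧
      ∀ t : ℝ, 0 < t → t < δ → ∀ x : K,
        |(∫ ξ, extendToV K f ξ ∂(X.p t (x : V))) - f x| < ε := by
  refine ⟨fun t ht f => ⟨?_, ?_⟩, fun f ε hε => ?_⟩
  · refine continuous_of_uniform_approx_of_continuous fun U hU => ?_
    obtain ⟨ε, hε, hεU⟩ := Metric.mem_uniformity_dist.1 hU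
    obtain ⟨n, c, u, hu, h⟩ := approx hK f (half_pos hε)
    refine ⟨fun x : K => ∑ i, c i * Real.exp (-φ t (u i) - ⟪ψ t (u i), (x : V)⟫), by fun_prop,
      fun x => hεU ?_⟩
    rw [Real.dist_eq]
    exact lt_of_le_of_lt (int_approx hK X f hu h ht x) (half_lt_self hε)
  · rw [Metric.tendsto_nhds]
    intro ε hε
    obtain ⟨n, c, u, hu, h⟩ := approx hK f (half_pos hε)
    have hlim : Tendsto (fun x : K => ∑ i, c i * Real.exp (-φ t (u i) - ⟪ψ t (u i), (x : V)⟫))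
        (cocompact K) (𝓝 0) := by
      have := tendsto_finsetSum (Finset.univ : Finset (Fin n)) fun i _ =>
        (exp_tendsto hK (psi_strict hK X ht (hu i)) (φ t (u i))).const_mul (c i)
      simpa using this
    filter_upwards [(Metric.tendsto_nhds.1 hlim) (ε / 2) (half_pos hε)] with x hx
    have h2 := int_approx hK X f hu h ht x
    rw [Real.dist_eq, sub_zero] at hx ⊢
    rw [abs_lt] at hx ⊢
    rw [abs_le] at h2
    constructor <;> linarith [h2.1, h2.2, hx.1, hx.2]
  · have hε4 : 0 < ε / 4 := by positivity
    obtain ⟨n, c, u, hu, h⟩ := approx hK f hε4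
    have hev := sum_unif hK X c hu hε4
    obtain ⟨δ, hδ, hsub⟩ := mem_nhdsGT_iff_exists_Ioo_subset.1 hev
    refine ⟨δ, hδ, fun t ht htδ x => ?_⟩
    have h1 := hsub ⟨ht, htδ⟩ x
    have h2 := int_approx hK X f hu h ht.le x
    have h3 := h x
    rw [abs_le] at h1 h2
    rw [abs_lt] at h3 ⊢
    constructor <;> linarith [h1.1, h1.2, h2.1, h2.2, h3.1, h3.2]
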